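/- arXiv:1903.04196 — 4 statements merged into one kernel-verified Lean document; each statement's English description precedes it below -/
import Mathlib

section
/- Let X be a nonempty set and f, g : X → [−∞,∞]; fix ε₀ > 0; extended-real arithmetic uses a − b := a + (−b) with (−∞) + ∞ = ∞ + (−∞) = −∞. (a) Suppose −∞ < sup_x f(x) and for all 0 < ε < ε₀ one has sup_x f(x) ≤ sup_x (f(x) − εg(x)) < ∞. Then there exists a sequence (x_n) in X with lim_n f(x_n) = sup_x f(x) and limsup_n g(x_n) ≤ 0. (b) Suppose inf_x f(x) < ∞ and for all 0 < ε < ε₀ one has inf_x f(x) ≥ inf_x (f(x) − εg(x)) > −∞. Then there exists a sequence (x_n) in X with lim_n f(x_n) = inf_x f(x) and liminf_n g(x_n) ≥ 0. -/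
open Filter Topology

/-- One can be simultaneously almost optimal for `f` and almost nonpositive for `g`. -/
lemma exists_sub_lt_and_lt {X : Type*} (f g : X → EReal) {ε₀ : ℝ} (hε₀ : 0 < ε₀)
    (h : ∀ ε : ℝ, 0 < ε → ε < ε₀ →
      (⨆ x, f x) ≤ (⨆ x, (f x - (ε : EReal) * g x)) ∧
        (⨆ x, (f x - (ε : EReal) * g x)) < ⊤)
    {S : ℝ} (hS : (⨆ x, f x) = S) {δ : ℝ} (hδ : 0 < δ) :
    ∃ x, ((S - δ : ℝ) : EReal) < f x ∧ g x < (δ : EReal) := by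
  obtain ⟨h₁, h₂⟩ := h (ε₀ / 2) (by linarith) (by linarith)
  obtain ⟨C, hC⟩ : ∃ C : ℝ, (⨆ x, (f x - ((ε₀ / 2 : ℝ) : EReal) * g x)) = C := by
    refine ⟨_, (EReal.coe_toReal h₂.ne ?_).symm⟩
    rw [hS] at h₁
    exact ((EReal.bot_lt_coe S).trans_le h₁).ne'
  obtain ⟨ε, hεe, hε⟩ : ∃ ε : ℝ,
      (ε < ε₀ / 2 ∧ ε < δ ∧ ε ^ 2 + ε / (ε₀ / 2) * (C - S + δ) < δ) ∧ 0 < ε := by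
    have hc : Tendsto (fun ε : ℝ => ε ^ 2 + ε / (ε₀ / 2) * (C - S + δ)) (𝓝[>] 0) (𝓝 0) := by
      have : Continuous (fun ε : ℝ => ε ^ 2 + ε / (ε₀ / 2) * (C - S + δ)) := by fun_prop
      simpa using (this.tendsto 0).mono_left nhdsWithin_le_nhds
    have hi : Tendsto (fun ε : ℝ => ε) (𝓝[>] 0) (𝓝 0) := nhdsWithin_le_nhds
    have hev := (hi.eventually_lt_const (half_pos hε₀)).and
      ((hi.eventually_lt_const hδ).and (hc.eventually_lt_const hδ))
    exact (hev.and self_mem_nhdsWithin).exists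
  obtain ⟨hε₁, hε₂, hε₃⟩ := hεe
  have hlt : ((S - ε ^ 2 : ℝ) : EReal) < ⨆ x, (f x - (ε : EReal) * g x) := by
    refine lt_of_lt_of_le ?_ (h ε hε (by linarith)).1
    rw [hS]
    exact EReal.coe_lt_coe_iff.2 (by nlinarith)
  obtain ⟨x, hx⟩ := lt_iSup_iff.1 hlt
  have hfS : f x ≤ S := hS ▸ le_iSup f x
  have hxC : f x - ((ε₀ / 2 : ℝ) : EReal) * g x ≤ C :=
    hC ▸ le_iSup (fun x => f x - ((ε₀ / 2 : ℝ) : EReal) * g x) x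
  refine ⟨x, ?_⟩
  generalize f x = a at *
  generalize g x = b at *
  induction a with
  | bot => simp [sub_eq_add_neg] at hx
  | top => simp at hfS
  | coe a =>
    induction b with
    | bot =>
      rw [EReal.coe_mul_bot_of_pos (half_pos hε₀)] at hxC
      simp [sub_eq_add_neg] at hxC
    | top =>
      rw [EReal.coe_mul_top_of_pos hε] at hx
      simp [sub_eq_add_neg] at hx
    | coe b =>
      norm_cast at hx hfS hxC ⊢
      constructor
      · set t := ε / (ε₀ / 2) with ht
        have htε : ε = t * (ε₀ / 2) := by rw [ht]; field_simp
        have ht₀ : 0 < t := by positivity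
        have ht₁ : t < 1 := (div_lt_one (half_pos hε₀)).2 hε₁
        have h₃ : t * (a - ε₀ / 2 * b) ≤ t * C := mul_le_mul_of_nonneg_left hxC ht₀.le
        have h₄ : ε * b = t * (ε₀ / 2 * b) := by rw [htε]; ring
        by_contra! hcon
        have h₅ : (1 - t) * a ≤ (1 - t) * (S - δ) :=
          mul_le_mul_of_nonneg_left hcon (by linarith)
        linarith
      · have : ε * b < ε * ε := by nlinarith
        exact (lt_of_mul_lt_mul_left this hε.le).trans hε₂

lemma exists_seq_tendsto_iSup_limsup_le {X : Type*} (f g : X → EReal) {ε₀ : ℝ} (hε₀ : 0 < ε₀)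
    (hf : ⊥ < ⨆ x, f x)
    (h : ∀ ε : ℝ, 0 < ε → ε < ε₀ →
      (⨆ x, f x) ≤ (⨆ x, (f x - (ε : EReal) * g x)) ∧
        (⨆ x, (f x - (ε : EReal) * g x)) < ⊤) :
    ∃ xs : ℕ → X, Tendsto (fun n => f (xs n)) atTop (𝓝 (⨆ x, f x)) ∧
      limsup (fun n => g (xs n)) atTop ≤ 0 := by
  obtain ⟨S, hS⟩ : ∃ S : ℝ, (⨆ x, f x) = S := by
    obtain ⟨h₁, h₂⟩ := h (ε₀ / 2) (by linarith) (by linarith)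
    exact ⟨_, (EReal.coe_toReal (h₁.trans_lt h₂).ne hf.ne').symm⟩
  choose xs hxf hxg using fun n : ℕ =>
    exists_sub_lt_and_lt f g hε₀ h hS (Nat.one_div_pos_of_nat (α := ℝ) (n := n))
  have hδ := tendsto_one_div_add_atTop_nhds_zero_nat (𝕜 := ℝ)
  refine ⟨xs, ?_, ?_⟩
  · refine tendsto_of_tendsto_of_tendsto_of_le_of_le ?_ tendsto_const_nhds
      (fun n => (hxf n).le) (fun n => le_iSup f (xs n))
    rw [hS]
    exact (continuous_coe_real_ereal.tendsto S).comp (by simpa using hδ.const_sub S)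
  · have h0 := (continuous_coe_real_ereal.tendsto 0).comp hδ
    calc limsup (fun n => g (xs n)) atTop
        ≤ limsup (fun n : ℕ => ((1 / ((n : ℝ) + 1) : ℝ) : EReal)) atTop :=
          limsup_le_limsup (Eventually.of_forall fun n => (hxg n).le)
      _ = 0 := h0.limsup_eq

lemma EReal.iSup_neg {ι : Sort*} (u : ι → EReal) : (⨆ i, -u i) = -⨅ i, u i :=
  (EReal.negOrderIso.map_iInf u).symm

/-- Lemma 7.8 in Feng–Kurtz, corrected.
For arbitrary functions `f g : X → [-∞,∞]` on a nonempty set, under the stated one-sided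
bounds for all `0 < ε < ε₀`, one can find optimizing sequences. -/
theorem stmt6 {X : Type*} [Nonempty X] (f g : X → EReal) (ε₀ : ℝ) (hε₀ : 0 < ε₀) :
    ((⊥ < ⨆ x, f x) →
      (∀ ε : ℝ, 0 < ε → ε < ε₀ →
        (⨆ x, f x) ≤ (⨆ x, (f x - (ε : EReal) * g x)) ∧
          (⨆ x, (f x - (ε : EReal) * g x)) < ⊤) →
      ∃ xs : ℕ → X,
        Tendsto (fun n => f (xs n)) atTop (𝓝 (⨆ x, f x)) ∧
          limsup (fun n => g (xs n)) atTop ≤ 0) ∧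
    ((⨅ x, f x) < ⊤ →
      (∀ ε : ℝ, 0 < ε → ε < ε₀ →
        (⨅ x, (f x - (ε : EReal) * g x)) ≤ (⨅ x, f x) ∧
          ⊥ < (⨅ x, (f x - (ε : EReal) * g x))) →
      ∃ xs : ℕ → X,
        Tendsto (fun n => f (xs n)) atTop (𝓝 (⨅ x, f x)) ∧
          0 ≤ liminf (fun n => g (xs n)) atTop) := by
  refine ⟨exists_seq_tendsto_iSup_limsup_le f g hε₀, fun hf h => ?_⟩
  have hneg : ∀ ε : ℝ, 0 < ε → ε < ε₀ →
      (⨆ x, (-f x - (ε : EReal) * -g x)) = -⨅ x, (f x - (ε : EReal) * g x) := by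
    intro ε hε hε'
    rw [← EReal.iSup_neg]
    congr 1 with x
    have hx : ⊥ < f x + -((ε : EReal) * g x) :=
      (h ε hε hε').2.trans_le (iInf_le (fun x => f x - (ε : EReal) * g x) x)
    obtain ⟨h₁, h₂⟩ := EReal.bot_lt_add_iff.1 hx
    rw [sub_eq_add_neg (f x), EReal.neg_add (Or.inl h₁.ne') (Or.inr h₂.ne'), mul_neg]
  obtain ⟨xs, hxf, hxg⟩ := exists_seq_tendsto_iSup_limsup_le (fun x => -f x) (fun x => -g x) hε₀
    (by rwa [EReal.iSup_neg, EReal.lt_neg_comm, EReal.neg_bot])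
    (fun ε hε hε' => by
      rw [hneg ε hε hε', EReal.iSup_neg, EReal.neg_le_neg_iff, EReal.neg_lt_comm, EReal.neg_top]
      exact h ε hε hε')
  refine ⟨xs, ?_, ?_⟩
  · rw [EReal.iSup_neg] at hxf
    simpa using hxf.neg
  · have := EReal.limsup_neg (f := atTop) (v := fun n => g (xs n))
    rw [← EReal.neg_le_neg_iff, neg_zero, ← this]
    exact hxg
end

section
/- Let X be a topological space, H_† ⊆ LSC_l(X) × USC_u(X) and H_‡ ⊆ USC_u(X) × LSC_l(X). Fix λ > ε > 0 and h : X → [−∞,∞]. (a) If u is a viscosity subsolution of f − λH_† f = h, then u is a viscosity subsolution of f − εH_† f = u − ε(u − h)/λ, i.e. of the equation with right-hand side x ↦ u(x) − (ε/λ)(u(x) − h(x)). (b) If v is a viscosity supersolution of f − λH_‡ f = h, then v is a viscosity supersolution of f − εH_‡ f = v − ε(v − h)/λ. -/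
open Filter Topology

variable {X : Type*} [TopologicalSpace X]

/-- `USC_u(X)`: upper semicontinuous `X → [-∞,∞]` functions bounded from above. -/
def USCu (X : Type*) [TopologicalSpace X] : Set (X → EReal) :=
  {f | UpperSemicontinuous f ∧ (⨆ x, f x) < ⊤}

/-- `LSC_l(X)`: lower semicontinuous `X → [-∞,∞]` functions bounded from below. -/
def LSCl (X : Type*) [TopologicalSpace X] : Set (X → EReal) :=
  {f | LowerSemicontinuous f ∧ ⊥ < ⨅ x, f x}

/-- `u` is a viscosity subsolution of `f - λ H f = h` for the operator
`H ⊆ LSC_l(X) × USC_u(X)` (given as a set of pairs). -/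
def EVSubsol (H : Set ((X → EReal) × (X → EReal))) (lam : ℝ) (h : X → EReal)
    (u : X → EReal) : Prop :=
  u ∈ USCu X ∧
    ∀ p ∈ H, (⨆ x, (u x - p.1 x)) < ⊤ →
      ∃ xs : ℕ → X,
        Tendsto (fun n => u (xs n) - p.1 (xs n)) atTop (𝓝 (⨆ x, (u x - p.1 x))) ∧
          limsup (fun n => u (xs n) - (lam : EReal) * p.2 (xs n) - h (xs n)) atTop ≤ 0

/-- `v` is a viscosity supersolution of `f - λ H f = h` for the operator
`H ⊆ USC_u(X) × LSC_l(X)` (given as a set of pairs). -/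
def EVSupersol (H : Set ((X → EReal) × (X → EReal))) (lam : ℝ) (h : X → EReal)
    (v : X → EReal) : Prop :=
  v ∈ LSCl X ∧
    ∀ p ∈ H, ⊥ < (⨅ x, (v x - p.1 x)) →
      ∃ xs : ℕ → X,
        Tendsto (fun n => v (xs n) - p.1 (xs n)) atTop (𝓝 (⨅ x, (v x - p.1 x))) ∧
          0 ≤ liminf (fun n => v (xs n) - (lam : EReal) * p.2 (xs n) - h (xs n)) atTop

theorem EReal.monotone_const_mul_coe_of_pos {c : ℝ} (hc : 0 < c) :
    Monotone fun a : EReal => (c : EReal) * a :=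
  fun _ _ hab => mul_le_mul_of_nonneg_left hab (EReal.coe_nonneg.2 hc.le)

/-- The residual of the equation with parameter `ε` and right-hand side `u - (ε / lam) (u - h)` is
`ε / lam` times the residual of the equation with parameter `lam` and right-hand side `h`, with
no finiteness assumption on the values involved. -/
theorem resolvent_residual_eq {lam ε : ℝ} (hε : 0 < ε) (hlam : 0 < lam) (u g h : EReal) :
    u - (ε : EReal) * g - (u - ((ε / lam : ℝ) : EReal) * (u - h)) =
      ((ε / lam : ℝ) : EReal) * (u - (lam : EReal) * g - h) := by
  have hc : 0 < ε / lam := div_pos hε hlam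
  induction u <;> induction g <;> induction h
  case coe.coe.coe a b c =>
    norm_cast
    field_simp
    ring
  all_goals
    simp only [sub_eq_add_neg, EReal.coe_mul_top_of_pos, EReal.coe_mul_bot_of_pos, hε, hlam, hc,
      EReal.neg_top, EReal.neg_bot, EReal.bot_add, EReal.add_bot, EReal.top_add_coe,
      EReal.coe_add_top, EReal.top_add_top, ← EReal.coe_mul, ← EReal.coe_neg, ← EReal.coe_add]

/-- Lemma 4.2: a subsolution to `f - λ H_† f = h` is a subsolution to
`f - ε H_† f = u - ε (u - h)/λ`, and the analogous statement for supersolutions. -/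
theorem stmt8 (Hd Hdd : Set ((X → EReal) × (X → EReal)))
    (hHd : ∀ p ∈ Hd, p.1 ∈ LSCl X ∧ p.2 ∈ USCu X)
    (hHdd : ∀ p ∈ Hdd, p.1 ∈ USCu X ∧ p.2 ∈ LSCl X)
    (lam ε : ℝ) (hε : 0 < ε) (hlam : ε < lam) (h : X → EReal) :
    (∀ u : X → EReal, EVSubsol Hd lam h u →
      EVSubsol Hd ε (fun x => u x - ((ε / lam : ℝ) : EReal) * (u x - h x)) u) ∧
    (∀ v : X → EReal, EVSupersol Hdd lam h v →
      EVSupersol Hdd ε (fun x => v x - ((ε / lam : ℝ) : EReal) * (v x - h x)) v) := by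
  have hl : 0 < lam := hε.trans hlam
  have hc : 0 < ε / lam := div_pos hε hl
  have hmono := EReal.monotone_const_mul_coe_of_pos hc
  have hcont : Continuous fun a : EReal => ((ε / lam : ℝ) : EReal) * a :=
    continuous_iff_continuousAt.2 fun a =>
      (EReal.continuousAt_mul (p := (((ε / lam : ℝ) : EReal), a)) (by simp [hc.ne']) (by simp [hc.ne'])
        (by simp) (by simp)).comp (by fun_prop)
  refine ⟨fun u hu => ⟨hu.1, fun p hp hsup => ?_⟩, fun v hv => ⟨hv.1, fun p hp hinf => ?_⟩⟩
  · obtain ⟨xs, hxs, hle⟩ := hu.2 p hp hsup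
    refine ⟨xs, hxs, ?_⟩
    simp only [resolvent_residual_eq hε hl]
    have key := hmono.map_limsup_of_continuousAt
      (fun n => u (xs n) - (lam : EReal) * p.2 (xs n) - h (xs n)) (F := atTop) hcont.continuousAt
    have hbound := hmono hle
    simp only [mul_zero] at hbound
    exact key.symm.trans_le hbound
  · obtain ⟨xs, hxs, hle⟩ := hv.2 p hp hinf
    refine ⟨xs, hxs, ?_⟩
    simp only [resolvent_residual_eq hε hl]
    have key := hmono.map_liminf_of_continuousAt
      (fun n => v (xs n) - (lam : EReal) * p.2 (xs n) - h (xs n)) (F := atTop) hcont.continuousAt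
    have hbound := hmono hle
    simp only [mul_zero] at hbound
    exact hbound.trans_eq key
end

section
/- Let X be a topological space and R(λ) : C_b(X) → C_b(X), λ > 0, a contractive pseudo-resolvent. Define Ĥ := {(R(λ)h, (R(λ)h − h)/λ) : λ > 0, h ∈ C_b(X)} ⊆ C_b(X) × C_b(X). Then Ĥ is dissipative: for all (f₁,g₁), (f₂,g₂) ∈ Ĥ and all μ > 0, ‖f₁ − μg₁ − (f₂ − μg₂)‖ ≥ ‖f₁ − f₂‖; and Ĥ satisfies the range condition: for every λ > 0, the closure in supremum norm of the domain D(Ĥ) := {f : ∃g, (f,g) ∈ Ĥ} is contained in the range {f − λg : (f,g) ∈ Ĥ} of (1 − λĤ). -/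
open Filter Topology BoundedContinuousFunction

variable {X : Type*} [TopologicalSpace X]

/-- Viscosity subsolution of `f - λ H f = h` for an operator `H ⊆ C_b(X) × C_b(X)`. -/
def VSubsol (H : Set ((X →ᵇ ℝ) × (X →ᵇ ℝ))) (lam : ℝ) (h : X →ᵇ ℝ) (u : X → ℝ) : Prop :=
  UpperSemicontinuous u ∧ BddAbove (Set.range u) ∧
    ∀ p ∈ H, ∃ xs : ℕ → X,
      Tendsto (fun n => u (xs n) - p.1 (xs n)) atTop (𝓝 (⨆ x, (u x - p.1 x))) ∧
        limsup (fun n => ((u (xs n) - lam * p.2 (xs n) - h (xs n) : ℝ) : EReal)) atTop ≤ 0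

/-- Viscosity supersolution of `f - λ H f = h` for an operator `H ⊆ C_b(X) × C_b(X)`. -/
def VSupersol (H : Set ((X →ᵇ ℝ) × (X →ᵇ ℝ))) (lam : ℝ) (h : X →ᵇ ℝ) (v : X → ℝ) : Prop :=
  LowerSemicontinuous v ∧ BddBelow (Set.range v) ∧
    ∀ p ∈ H, ∃ xs : ℕ → X,
      Tendsto (fun n => v (xs n) - p.1 (xs n)) atTop (𝓝 (⨅ x, (v x - p.1 x))) ∧
        (0 : EReal) ≤ liminf (fun n => ((v (xs n) - lam * p.2 (xs n) - h (xs n) : ℝ) : EReal)) atTop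

/-- Viscosity solution: both a viscosity sub- and supersolution. -/
def VSol (H : Set ((X →ᵇ ℝ) × (X →ᵇ ℝ))) (lam : ℝ) (h : X →ᵇ ℝ) (u : X → ℝ) : Prop :=
  VSubsol H lam h u ∧ VSupersol H lam h u

/-- Bounded and uniform convergence on compacts (buc) for a sequence in `C_b(X)`. -/
def BucConv (fs : ℕ → X →ᵇ ℝ) (f : X →ᵇ ℝ) : Prop :=
  (∃ C : ℝ, ∀ n, ‖fs n‖ ≤ C) ∧
    ∀ K : Set X, IsCompact K → TendstoUniformlyOn (fun n x => fs n x) (fun x => f x) atTop K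

/-- `D ⊆ C_b(X)` is buc-dense. -/
def BucDense (D : Set (X →ᵇ ℝ)) : Prop :=
  ∀ r : ℝ, 0 < r → ∀ h : X →ᵇ ℝ, ‖h‖ ≤ r → ∀ K : Set X, IsCompact K → ∀ ε : ℝ, 0 < ε →
    ∃ h' ∈ D, ‖h'‖ ≤ r ∧ ∀ x ∈ K, |h x - h' x| ≤ ε

/-- The family `R(λ)`, `λ > 0`, is a pseudo-resolvent on `C_b(X)`. -/
def IsPseudoResolvent (R : ℝ → (X →ᵇ ℝ) → (X →ᵇ ℝ)) : Prop :=
  (∀ l : ℝ, 0 < l → R l 0 = 0) ∧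
    ∀ a b : ℝ, 0 < a → a < b → ∀ h : X →ᵇ ℝ,
      R b h = R a (R b h - (a / b) • (R b h - h))

/-- A map `T : C_b(X) → C_b(X)` is contractive. -/
def Contractive (T : (X →ᵇ ℝ) → (X →ᵇ ℝ)) : Prop :=
  ∀ f₁ f₂ : X →ᵇ ℝ,
    (⨆ x, (T f₁ x - T f₂ x)) ≤ (⨆ x, (f₁ x - f₂ x)) ∧
      (⨅ x, (f₁ x - f₂ x)) ≤ ⨅ x, (T f₁ x - T f₂ x)

/-- A contractive map is nonexpansive for the supremum norm. -/
theorem Contractive.norm_sub_le {T : (X →ᵇ ℝ) → (X →ᵇ ℝ)} (hT : Contractive T)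
    (f₁ f₂ : X →ᵇ ℝ) : ‖T f₁ - T f₂‖ ≤ ‖f₁ - f₂‖ := by
  refine (BoundedContinuousFunction.norm_le (norm_nonneg _)).2 fun x => ?_
  have : Nonempty X := ⟨x⟩
  obtain ⟨hsup, hinf⟩ := hT f₁ f₂
  have hbound : ∀ y, |f₁ y - f₂ y| ≤ ‖f₁ - f₂‖ := fun y => (f₁ - f₂).norm_coe_le_norm y
  have hT_bound : ∀ y, |T f₁ y - T f₂ y| ≤ ‖T f₁ - T f₂‖ :=
    fun y => (T f₁ - T f₂).norm_coe_le_norm y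
  have hle : T f₁ x - T f₂ x ≤ ⨆ y, (T f₁ y - T f₂ y) :=
    le_ciSup (f := fun y => T f₁ y - T f₂ y)
      ⟨_, Set.forall_mem_range.2 fun y => (abs_le.1 (hT_bound y)).2⟩ x
  have hge : ⨅ y, (T f₁ y - T f₂ y) ≤ T f₁ x - T f₂ x :=
    ciInf_le (f := fun y => T f₁ y - T f₂ y)
      ⟨_, Set.forall_mem_range.2 fun y => (abs_le.1 (hT_bound y)).1⟩ x
  have hsup_le : ⨆ y, (f₁ y - f₂ y) ≤ ‖f₁ - f₂‖ := ciSup_le fun y => (abs_le.1 (hbound y)).2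
  have hle_inf : -‖f₁ - f₂‖ ≤ ⨅ y, (f₁ y - f₂ y) := le_ciInf fun y => (abs_le.1 (hbound y)).1
  exact abs_le.2 ⟨hle_inf.trans (hinf.trans hge), hle.trans (hsup.trans hsup_le)⟩

/-- By convexity of the norm, if `t ↦ ‖F - t • G‖` is at least `‖F‖` at some `0 < s`, then it is
at least `‖F‖` at every larger parameter. -/
theorem norm_le_norm_sub_smul_of_le {E : Type*} [SeminormedAddCommGroup E] [NormedSpace ℝ E]
    {F G : E} {s t : ℝ} (hs : 0 < s) (hst : s ≤ t) (h : ‖F‖ ≤ ‖F - s • G‖) :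
    ‖F‖ ≤ ‖F - t • G‖ := by
  have ht : 0 < t := hs.trans_le hst
  have hpos : 0 < s / t := div_pos hs ht
  have hcomb : F - s • G = (1 - s / t) • F + (s / t) • (F - t • G) := by
    rw [smul_sub, smul_smul, div_mul_cancel₀ _ ht.ne']
    module
  have hle : ‖F - s • G‖ ≤ (1 - s / t) * ‖F‖ + s / t * ‖F - t • G‖ := by
    rw [hcomb]
    refine (norm_add_le _ _).trans_eq ?_
    rw [norm_smul, norm_smul, Real.norm_of_nonneg (sub_nonneg.2 ((div_le_one ht).2 hst)),
      Real.norm_of_nonneg hpos.le]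
  exact le_of_mul_le_mul_left (by linarith) hpos

/-- For `0 < a ≤ b`, the pair `(f, g) = (R b h, (R b h - h) / b)` satisfies `f = R a (f - a • g)`. -/
theorem IsPseudoResolvent.apply_eq {R : ℝ → (X →ᵇ ℝ) → (X →ᵇ ℝ)} (hR : IsPseudoResolvent R)
    {a b : ℝ} (ha : 0 < a) (hab : a ≤ b) (h : X →ᵇ ℝ) :
    R a (R b h - a • b⁻¹ • (R b h - h)) = R b h := by
  rcases hab.eq_or_lt with rfl | hlt
  · rw [smul_inv_smul₀ ha.ne', sub_sub_cancel]
  · rw [smul_smul, ← div_eq_mul_inv, ← hR.2 a b ha hlt h]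

/-- Proposition 4.5 (b): the operator `Ĥ` extracted from a contractive
pseudo-resolvent is dissipative and satisfies the range condition. -/
theorem stmt12 (R : ℝ → (X →ᵇ ℝ) → (X →ᵇ ℝ))
    (hpr : IsPseudoResolvent R) (hcontr : ∀ l : ℝ, 0 < l → Contractive (R l)) :
    -- dissipativity
    (∀ p q : (X →ᵇ ℝ) × (X →ᵇ ℝ),
      p ∈ {p : (X →ᵇ ℝ) × (X →ᵇ ℝ) | ∃ m : ℝ, 0 < m ∧ ∃ k : X →ᵇ ℝ, p = (R m k, m⁻¹ • (R m k - k))} →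
      q ∈ {p : (X →ᵇ ℝ) × (X →ᵇ ℝ) | ∃ m : ℝ, 0 < m ∧ ∃ k : X →ᵇ ℝ, p = (R m k, m⁻¹ • (R m k - k))} →
      ∀ μ : ℝ, 0 < μ →
        ‖p.1 - q.1‖ ≤ ‖p.1 - μ • p.2 - (q.1 - μ • q.2)‖) ∧
    -- the range condition
    (∀ l : ℝ, 0 < l →
      closure {f : X →ᵇ ℝ |
          ∃ g : X →ᵇ ℝ, (f, g) ∈ {p : (X →ᵇ ℝ) × (X →ᵇ ℝ) |
            ∃ m : ℝ, 0 < m ∧ ∃ k : X →ᵇ ℝ, p = (R m k, m⁻¹ • (R m k - k))}} ⊆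
        {u : X →ᵇ ℝ | ∃ p ∈ {p : (X →ᵇ ℝ) × (X →ᵇ ℝ) |
            ∃ m : ℝ, 0 < m ∧ ∃ k : X →ᵇ ℝ, p = (R m k, m⁻¹ • (R m k - k))},
          u = p.1 - l • p.2}) := by
  constructor
  · rintro _ _ ⟨m, hm, k, rfl⟩ ⟨n, hn, j, rfl⟩ μ hμ
    have hcomm : ∀ (s : ℝ) (f₁ g₁ f₂ g₂ : X →ᵇ ℝ),
        f₁ - s • g₁ - (f₂ - s • g₂) = f₁ - f₂ - s • (g₁ - g₂) := by
      intro s f₁ g₁ f₂ g₂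
      module
    rw [hcomm]
    have hs : 0 < min μ (min m n) := lt_min hμ (lt_min hm hn)
    refine norm_le_norm_sub_smul_of_le hs (min_le_left _ _) ?_
    have hk := hpr.apply_eq hs ((min_le_right μ _).trans (min_le_left m n)) k
    have hj := hpr.apply_eq hs ((min_le_right μ _).trans (min_le_right m n)) j
    have hle := (hcontr _ hs).norm_sub_le
      (R m k - min μ (min m n) • m⁻¹ • (R m k - k)) (R n j - min μ (min m n) • n⁻¹ • (R n j - j))
    rwa [hk, hj, hcomm] at hle
  · intro l hl u _
    refine ⟨_, ⟨l, hl, u, rfl⟩, ?_⟩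
    rw [smul_inv_smul₀ hl.ne', sub_sub_cancel]
end

section
/- Let X be a topological space in which all compact subsets are metrizable, and let H_†, H_‡ ⊆ C_b(X) × C_b(X). Let R(λ) : C_b(X) → C_b(X), λ > 0, be a family of operators that is locally strictly equi-continuous on bounded sets: for each λ₀ > 0, each compact K ⊆ X and all r, δ > 0 there is a compact K̂ ⊆ X such that sup_{x∈K}|R(λ)f(x) − R(λ)g(x)| ≤ δ·sup_{x∈X}|f(x) − g(x)| + sup_{x∈K̂}|f(x) − g(x)| for all 0 < λ ≤ λ₀ and all f, g ∈ C_b(X) with ‖f‖ ∨ ‖g‖ ≤ r. Let D ⊆ C_b(X) be quasi-dense and suppose that for every λ > 0 and h ∈ D, R(λ)h is a viscosity subsolution of f − λH_† f = h and a viscosity supersolution of f − λH_‡ f = h. Define A_† := {(f, 0) : (f,g) ∈ H_†} and A_‡ := {(f, 0) : (f,g) ∈ H_‡}, and assume the comparison principle: for all h₁, h₂ ∈ D, every viscosity subsolution u of f − A_† f = h₁ and every viscosity supersolution v of f − A_‡ f = h₂ satisfy sup_x(u(x) − v(x)) ≤ sup_x(h₁(x) − h₂(x)). Then for every h ∈ D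 and every sequence λ_n > 0 with λ_n → 0, the sequence R(λ_n)h converges buc to h. -/
open Filter Topology BoundedContinuousFunction

variable {X : Type*} [TopologicalSpace X]

/-- The operator `{(f, 0) : (f, g) ∈ H}`. -/
def zeroOp (H : Set ((X →ᵇ ℝ) × (X →ᵇ ℝ))) : Set ((X →ᵇ ℝ) × (X →ᵇ ℝ)) :=
  {p' | ∃ p ∈ H, p' = (p.1, 0)}

/-- The operator `{(-f, -g) : (f, g) ∈ H}`. -/
def negOp (H : Set ((X →ᵇ ℝ) × (X →ᵇ ℝ))) : Set ((X →ᵇ ℝ) × (X →ᵇ ℝ)) :=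
  {p | -p ∈ H}

theorem zeroOp_negOp (H : Set ((X →ᵇ ℝ) × (X →ᵇ ℝ))) : zeroOp (negOp H) = negOp (zeroOp H) := by
  ext ⟨a, b⟩
  constructor
  · rintro ⟨p, hp, hab⟩
    refine ⟨-p, hp, ?_⟩
    rw [hab]
    simp
  · rintro ⟨p, hp, hab⟩
    refine ⟨-p, ?_, ?_⟩
    · simpa [negOp] using hp
    · simp only [Prod.neg_mk, Prod.mk.injEq, neg_eq_zero] at hab
      rw [Prod.mk.injEq]
      exact ⟨by rw [Prod.fst_neg, ← hab.1, neg_neg], hab.2⟩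

theorem iInf_eq_neg_iSup_neg {ι : Type*} (f : ι → ℝ) : ⨅ i, f i = -⨆ i, -f i := by
  rw [iInf, iSup, Real.sInf_def, ← Set.image_neg_eq_neg, ← Set.range_comp]
  rfl

/-- Supersolutions are the negatives of subsolutions of the negated equation. -/
theorem vSupersol_iff_neg (H : Set ((X →ᵇ ℝ) × (X →ᵇ ℝ))) (lam : ℝ) (h : X →ᵇ ℝ) (v : X → ℝ) :
    VSupersol H lam h v ↔ VSubsol (negOp H) lam (-h) (fun x => -v x) := by
  have husc : UpperSemicontinuous (fun x => -v x) ↔ LowerSemicontinuous v := by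
    constructor
    · intro hv x a ha
      filter_upwards [hv x (-a) (neg_lt_neg ha)] with y hy using neg_lt_neg_iff.mp hy
    · intro hv x a ha
      filter_upwards [hv x (-a) (neg_lt.mp ha)] with y hy using neg_lt.mp hy
  have hbdd : BddAbove (Set.range fun x => -v x) ↔ BddBelow (Set.range v) := by
    constructor
    · rintro ⟨C, hC⟩
      refine ⟨-C, ?_⟩
      rintro _ ⟨x, rfl⟩
      exact neg_le.mp (hC ⟨x, rfl⟩)
    · rintro ⟨C, hC⟩
      refine ⟨-C, ?_⟩
      rintro _ ⟨x, rfl⟩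
      exact neg_le_neg (hC ⟨x, rfl⟩)
  have hseq : ∀ (p : (X →ᵇ ℝ) × (X →ᵇ ℝ)) (xs : ℕ → X),
      (Tendsto (fun n => v (xs n) - p.1 (xs n)) atTop (𝓝 (⨅ x, (v x - p.1 x))) ∧
        (0 : EReal) ≤
          liminf (fun n => ((v (xs n) - lam * p.2 (xs n) - h (xs n) : ℝ) : EReal)) atTop) ↔
      (Tendsto (fun n => -v (xs n) - (-p).1 (xs n)) atTop (𝓝 (⨆ x, (-v x - (-p).1 x))) ∧
        limsup (fun n => ((-v (xs n) - lam * (-p).2 (xs n) - (-h) (xs n) : ℝ) : EReal)) atTop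
          ≤ 0) := by
    intro p xs
    have e1 : ∀ x, -v x - (-p).1 x = -(v x - p.1 x) := fun x => by simp; ring
    have e2 : (fun n => ((-v (xs n) - lam * (-p).2 (xs n) - (-h) (xs n) : ℝ) : EReal)) =
        -(fun n => ((v (xs n) - lam * p.2 (xs n) - h (xs n) : ℝ) : EReal)) := by
      funext n
      rw [Pi.neg_apply, ← EReal.coe_neg]
      congr 1
      simp
      ring
    rw [e2, EReal.limsup_neg, EReal.neg_le, neg_zero]
    simp only [e1]
    rw [iInf_eq_neg_iSup_neg]
    refine and_congr_left fun _ => ⟨fun ht => ?_, fun ht => ?_⟩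
    · simpa using ht.neg
    · simpa using ht.neg
  unfold VSupersol VSubsol
  rw [husc, hbdd]
  refine and_congr_right fun _ => and_congr_right fun _ => ⟨fun hv p hp => ?_, fun hv p hp => ?_⟩
  · obtain ⟨xs, hxs⟩ := hv (-p) hp
    refine ⟨xs, ?_⟩
    have := (hseq (-p) xs).mp hxs
    rwa [neg_neg] at this
  · obtain ⟨xs, hxs⟩ := hv (-p) (by simpa [negOp] using hp)
    exact ⟨xs, (hseq p xs).mpr hxs⟩

theorem bddAbove_range_sub (h f : X →ᵇ ℝ) : BddAbove (Set.range fun x => h x - f x) :=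
  (h - f).isBounded_range.bddAbove

theorem le_iSup_sub (h f : X →ᵇ ℝ) (x : X) : h x - f x ≤ ⨆ y, (h y - f y) :=
  le_ciSup (bddAbove_range_sub h f) x

/-- An upper semicontinuous majorant of `h` that does not increase `sup (h - f)` for any test
function `f` is a subsolution of the zero equation. -/
theorem vSubsol_zeroOp_of_majorant [Nonempty X] {H : Set ((X →ᵇ ℝ) × (X →ᵇ ℝ))} {h : X →ᵇ ℝ}
    {u : X → ℝ} (husc : UpperSemicontinuous u) (hbdd : BddAbove (Set.range u))
    (hle : ∀ x, h x ≤ u x)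
    (hsup : ∀ p ∈ H, ∀ x, u x - p.1 x ≤ ⨆ y, (h y - p.1 y)) :
    VSubsol (zeroOp H) 1 h u := by
  refine ⟨husc, hbdd, ?_⟩
  rintro _ ⟨p, hp, rfl⟩
  set S := ⨆ y, (h y - p.1 y) with hS
  have hex : ∀ n : ℕ, ∃ x, S - 1 / ((n : ℝ) + 1) < h x - p.1 x := fun n =>
    exists_lt_of_lt_ciSup (sub_lt_self _ Nat.one_div_pos_of_nat)
  choose xs hxs using hex
  have hlow : Tendsto (fun n : ℕ => S - 1 / ((n : ℝ) + 1)) atTop (𝓝 S) := by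
    simpa using tendsto_const_nhds.sub (tendsto_one_div_add_atTop_nhds_zero_nat (𝕜 := ℝ))
  have hth : Tendsto (fun n => h (xs n) - p.1 (xs n)) atTop (𝓝 S) :=
    tendsto_of_tendsto_of_tendsto_of_le_of_le hlow tendsto_const_nhds
      (fun n => (hxs n).le) (fun n => le_iSup_sub h p.1 (xs n))
  have htu : Tendsto (fun n => u (xs n) - p.1 (xs n)) atTop (𝓝 S) :=
    tendsto_of_tendsto_of_tendsto_of_le_of_le hth tendsto_const_nhds
      (fun n => sub_le_sub_right (hle _) _) (fun n => hsup p hp (xs n))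
  have hSu : ⨆ x, (u x - p.1 x) = S := by
    refine le_antisymm (ciSup_le (hsup p hp)) (ciSup_mono ⟨S, ?_⟩ fun x => ?_)
    · rintro _ ⟨x, rfl⟩
      exact hsup p hp x
    · exact sub_le_sub_right (hle x) _
  refine ⟨xs, ?_, ?_⟩
  · simpa only [hSu] using htu
  · have h0 : Tendsto (fun n => u (xs n) - h (xs n)) atTop (𝓝 0) := by
      simpa using htu.sub hth
    have h1 : Tendsto (fun n => ((u (xs n) - 1 * (0 : X →ᵇ ℝ) (xs n) - h (xs n) : ℝ) : EReal))
        atTop (𝓝 ((0 : ℝ) : EReal)) := by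
      refine (continuous_coe_real_ereal.tendsto 0).comp ?_
      simpa using h0
    exact h1.limsup_eq.le

theorem vSubsol_zeroOp_self [Nonempty X] (H : Set ((X →ᵇ ℝ) × (X →ᵇ ℝ))) (h : X →ᵇ ℝ) :
    VSubsol (zeroOp H) 1 h (fun x => h x) :=
  vSubsol_zeroOp_of_majorant h.continuous.upperSemicontinuous h.isBounded_range.bddAbove
    (fun _ => le_rfl) (fun p _ x => le_iSup_sub h p.1 x)

theorem vSupersol_zeroOp_self [Nonempty X] (H : Set ((X →ᵇ ℝ) × (X →ᵇ ℝ))) (h : X →ᵇ ℝ) :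
    VSupersol (zeroOp H) 1 h (fun x => h x) := by
  rw [vSupersol_iff_neg, ← zeroOp_negOp]
  exact vSubsol_zeroOp_self (negOp H) (-h)

/-- Every pair of the operator bounds a subsolution from above. -/
theorem VSubsol.le_add_iSup {H : Set ((X →ᵇ ℝ) × (X →ᵇ ℝ))} {lam : ℝ} {h : X →ᵇ ℝ} {u : X → ℝ}
    (hu : VSubsol H lam h u) (hlam : 0 ≤ lam) {p : (X →ᵇ ℝ) × (X →ᵇ ℝ)} (hp : p ∈ H) (y : X) :
    u y ≤ p.1 y + (⨆ x, (h x - p.1 x)) + lam * ‖p.2‖ := by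
  obtain ⟨-, ⟨C, hC⟩, hsub⟩ := hu
  obtain ⟨xs, ht, hlim⟩ := hsub p hp
  have hbdd : BddAbove (Set.range fun x => u x - p.1 x) := by
    refine ⟨C + ‖p.1‖, ?_⟩
    rintro _ ⟨x, rfl⟩
    have h1 : u x ≤ C := hC ⟨x, rfl⟩
    have h2 := (abs_le.mp (p.1.norm_coe_le_norm x)).1
    show u x - p.1 x ≤ C + ‖p.1‖
    linarith
  have hy : u y - p.1 y ≤ ⨆ x, (u x - p.1 x) := le_ciSup hbdd y
  suffices hS : (⨆ x, (u x - p.1 x)) ≤ (⨆ x, (h x - p.1 x)) + lam * ‖p.2‖ by linarith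
  refine le_of_forall_pos_le_add fun ε hε => ?_
  refine le_of_tendsto ht ?_
  have hev : ∀ᶠ n in atTop,
      ((u (xs n) - lam * p.2 (xs n) - h (xs n) : ℝ) : EReal) < (ε : EReal) :=
    eventually_lt_of_limsup_lt (hlim.trans_lt (by exact_mod_cast hε))
  filter_upwards [hev] with n hn
  have h1 : u (xs n) - lam * p.2 (xs n) - h (xs n) < ε := by exact_mod_cast hn
  have h2 : lam * p.2 (xs n) ≤ lam * ‖p.2‖ :=
    mul_le_mul_of_nonneg_left (abs_le.mp (p.2.norm_coe_le_norm _)).2 hlam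
  have h3 := le_iSup_sub h p.1 (xs n)
  linarith

/-- If all subsolutions of the zero equation lie below `h`, the domain of the operator is
non-empty. -/
theorem nonempty_of_subsol_le [Nonempty X] {H : Set ((X →ᵇ ℝ) × (X →ᵇ ℝ))} {h : X →ᵇ ℝ}
    (hle : ∀ u : X → ℝ, VSubsol (zeroOp H) 1 h u → ∀ x, u x ≤ h x) : H.Nonempty := by
  by_contra hne
  rw [Set.not_nonempty_iff_eq_empty] at hne
  let k : X →ᵇ ℝ := h + BoundedContinuousFunction.const X 1
  obtain ⟨x⟩ := ‹Nonempty X›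
  have := hle (fun x => k x) ⟨k.continuous.upperSemicontinuous, k.isBounded_range.bddAbove, by
    rintro _ ⟨p, hp, -⟩
    simp [hne] at hp⟩ x
  simp [k] at this
  linarith

/-- If all subsolutions of the zero equation lie below `h`, then `h - f` is nearly maximal at any
given point, for a suitable `f` in the domain of the operator. -/
theorem exists_add_iSup_lt [Nonempty X] {H : Set ((X →ᵇ ℝ) × (X →ᵇ ℝ))} {h : X →ᵇ ℝ}
    (hle : ∀ u : X → ℝ, VSubsol (zeroOp H) 1 h u → ∀ x, u x ≤ h x) (x : X) {ε : ℝ} (hε : 0 < ε) :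
    ∃ p ∈ H, p.1 x + (⨆ y, (h y - p.1 y)) < h x + ε := by
  obtain ⟨p₀, hp₀⟩ := nonempty_of_subsol_le hle
  have : Nonempty H := ⟨⟨p₀, hp₀⟩⟩
  let w : H → X → ℝ := fun p x => p.1.1 x + ⨆ y, (h y - p.1.1 y)
  have hw : ∀ p x, h x ≤ w p x := fun p x => by
    have := le_iSup_sub h p.1.1 x
    show h x ≤ p.1.1 x + ⨆ y, (h y - p.1.1 y)
    linarith
  have hbdd : ∀ x, BddBelow (Set.range fun p => w p x) := fun x => by
    refine ⟨h x, ?_⟩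
    rintro _ ⟨p, rfl⟩
    exact hw p x
  have hsub : VSubsol (zeroOp H) 1 h (fun x => ⨅ p, w p x) := by
    refine vSubsol_zeroOp_of_majorant ?_ ?_ (fun x => le_ciInf fun p => hw p x) ?_
    · exact upperSemicontinuous_ciInf hbdd fun p =>
        (p.1.1.continuous.add continuous_const).upperSemicontinuous
    · refine ⟨‖p₀.1‖ + ⨆ y, (h y - p₀.1 y), ?_⟩
      rintro _ ⟨x, rfl⟩
      refine (ciInf_le (hbdd x) ⟨p₀, hp₀⟩).trans ?_
      exact add_le_add_left (abs_le.mp (p₀.1.norm_coe_le_norm x)).2 _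
    · intro p hp x
      have : (⨅ p, w p x) ≤ p.1 x + ⨆ y, (h y - p.1 y) := ciInf_le (hbdd x) ⟨p, hp⟩
      linarith
  obtain ⟨p, hp⟩ := exists_lt_of_ciInf_lt ((hle _ hsub x).trans_lt (lt_add_of_pos_right _ hε))
  exact ⟨p.1, p.2, hp⟩

/-- One-sided convergence of subsolutions as `λ ↓ 0`. -/
theorem subsol_upper_bounds {H : Set ((X →ᵇ ℝ) × (X →ᵇ ℝ))} {h : X →ᵇ ℝ}
    (hle : ∀ u : X → ℝ, VSubsol (zeroOp H) 1 h u → ∀ x, u x ≤ h x)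
    {ls : ℕ → ℝ} (hpos : ∀ n, 0 < ls n) (hlim : Tendsto ls atTop (𝓝 0)) {us : ℕ → X → ℝ}
    (hus : ∀ n, VSubsol H (ls n) h (us n)) :
    (∃ C, ∀ n x, us n x ≤ C) ∧
      ∀ K : Set X, IsCompact K → ∀ ε : ℝ, 0 < ε → ∀ᶠ n in atTop, ∀ x ∈ K, us n x < h x + ε := by
  rcases isEmpty_or_nonempty X with hX | hX
  · exact ⟨⟨0, fun n x => isEmptyElim x⟩, fun K _ ε _ => .of_forall fun n x => isEmptyElim x⟩
  constructor
  · obtain ⟨p, hp⟩ := nonempty_of_subsol_le hle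
    obtain ⟨L, hL⟩ := hlim.bddAbove_range
    refine ⟨‖p.1‖ + (⨆ x, (h x - p.1 x)) + L * ‖p.2‖, fun n x => ?_⟩
    have h1 := (hus n).le_add_iSup (hpos n).le hp x
    have h2 : ls n * ‖p.2‖ ≤ L * ‖p.2‖ :=
      mul_le_mul_of_nonneg_right (hL ⟨n, rfl⟩) (norm_nonneg _)
    have h3 := (abs_le.mp (p.1.norm_coe_le_norm x)).2
    linarith
  · intro K hK ε hε
    refine hK.induction_on (p := fun s => ∀ᶠ n in atTop, ∀ x ∈ s, us n x < h x + ε)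
      (by simp) (fun s t hst ht => ht.mono fun n hn x hx => hn x (hst hx)) ?_ ?_
    · intro s t hs ht
      filter_upwards [hs, ht] with n h1 h2 x hx
      exact hx.elim (h1 x) (h2 x)
    · intro x _
      obtain ⟨p, hp, hpx⟩ := exists_add_iSup_lt hle x (half_pos hε)
      have hnhds : ∀ᶠ y in 𝓝 x, p.1 y + (⨆ z, (h z - p.1 z)) < h y + ε / 2 :=
        (p.1.continuous.add continuous_const).continuousAt.eventually_lt
          (h.continuous.add continuous_const).continuousAt hpx
      refine ⟨_, mem_nhdsWithin_of_mem_nhds hnhds, ?_⟩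
      have hsmall : Tendsto (fun n => ls n * ‖p.2‖) atTop (𝓝 0) := by
        simpa using hlim.mul_const ‖p.2‖
      filter_upwards [hsmall.eventually_lt_const (half_pos hε)] with n hn y hy
      have h1 := (hus n).le_add_iSup (hpos n).le hp y
      have h2 : p.1 y + (⨆ z, (h z - p.1 z)) < h y + ε / 2 := hy
      linarith

/-- Proposition 7.1: convergence `R(λ)h → h` buc as `λ ↓ 0`, via the
comparison principle for the zero operators `A_† = {(f,0)}`, `A_‡ = {(f,0)}`. -/
theorem stmt17 {Y : Type*} [TopologicalSpace Y]
    (hmet : ∀ K : Set Y, IsCompact K → TopologicalSpace.MetrizableSpace K)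
    (Hd Hdd : Set ((Y →ᵇ ℝ) × (Y →ᵇ ℝ)))
    (R : ℝ → (Y →ᵇ ℝ) → (Y →ᵇ ℝ))
    (hequi : ∀ l₀ : ℝ, 0 < l₀ → ∀ K : Set Y, IsCompact K → ∀ r : ℝ, 0 < r → ∀ δ : ℝ, 0 < δ →
      ∃ Khat : Set Y, IsCompact Khat ∧
        ∀ l : ℝ, 0 < l → l ≤ l₀ → ∀ f g : Y →ᵇ ℝ, max ‖f‖ ‖g‖ ≤ r → ∀ x ∈ K,
          |R l f x - R l g x| ≤ δ * ‖f - g‖ + ⨆ y : Khat, |f (y : Y) - g (y : Y)|)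
    (D : Set (Y →ᵇ ℝ)) (hD : BucDense D)
    (hsol : ∀ l : ℝ, 0 < l → ∀ h ∈ D,
      VSubsol Hd l h (fun x => R l h x) ∧ VSupersol Hdd l h (fun x => R l h x))
    (hcomp : ∀ h₁ ∈ D, ∀ h₂ ∈ D, ∀ u v : Y → ℝ,
      VSubsol {p' | ∃ p ∈ Hd, p' = (p.1, 0)} 1 h₁ u →
      VSupersol {p' | ∃ p ∈ Hdd, p' = (p.1, 0)} 1 h₂ v →
        (⨆ x, (u x - v x)) ≤ ⨆ x, (h₁ x - h₂ x)) :
    ∀ h ∈ D, ∀ ls : ℕ → ℝ, (∀ n, 0 < ls n) → Tendsto ls atTop (𝓝 0) →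
      BucConv (fun n => R (ls n) h) h := by
  intro h hh ls hpos hlim
  have hle : ∀ u : Y → ℝ, VSubsol (zeroOp Hd) 1 h u → ∀ x, u x ≤ h x := by
    intro u hu x
    have : Nonempty Y := ⟨x⟩
    have hc := hcomp h hh h hh u _ hu (vSupersol_zeroOp_self Hdd h)
    obtain ⟨C, hC⟩ := hu.2.1
    have hb : BddAbove (Set.range fun y => u y - h y) := by
      refine ⟨C + ‖h‖, ?_⟩
      rintro _ ⟨y, rfl⟩
      have h1 : u y ≤ C := hC ⟨y, rfl⟩
      have h2 := (abs_le.mp (h.norm_coe_le_norm y)).1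
      show u y - h y ≤ C + ‖h‖
      linarith
    have hx := (le_ciSup hb x).trans hc
    simp only [sub_self, ciSup_const] at hx
    linarith
  have hge : ∀ u : Y → ℝ, VSubsol (zeroOp (negOp Hdd)) 1 (-h) u → ∀ x, u x ≤ (-h) x := by
    intro u hu x
    have : Nonempty Y := ⟨x⟩
    have hv : VSupersol (zeroOp Hdd) 1 h (fun y => -u y) := by
      rw [vSupersol_iff_neg, ← zeroOp_negOp]
      simpa only [neg_neg] using hu
    have hc := hcomp h hh h hh _ _ (vSubsol_zeroOp_self Hd h) hv
    obtain ⟨C, hC⟩ := hu.2.1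
    have hb : BddAbove (Set.range fun y => h y - -u y) := by
      refine ⟨C + ‖h‖, ?_⟩
      rintro _ ⟨y, rfl⟩
      have h1 : u y ≤ C := hC ⟨y, rfl⟩
      have h2 := (abs_le.mp (h.norm_coe_le_norm y)).2
      show h y - -u y ≤ C + ‖h‖
      linarith
    have hx := (le_ciSup hb x).trans hc
    simp only [sub_self, ciSup_const] at hx
    rw [BoundedContinuousFunction.neg_apply]
    linarith
  obtain ⟨⟨C₁, hC₁⟩, hup⟩ := subsol_upper_bounds hle hpos hlim fun n => (hsol _ (hpos n) h hh).1
  obtain ⟨⟨C₂, hC₂⟩, hlow⟩ := subsol_upper_bounds hge hpos hlim fun n =>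
    (vSupersol_iff_neg _ _ _ _).mp (hsol _ (hpos n) h hh).2
  refine ⟨⟨max 0 (max C₁ C₂), fun n => ?_⟩, fun K hK => ?_⟩
  · refine (BoundedContinuousFunction.norm_le (le_max_left _ _)).mpr fun x => ?_
    rw [Real.norm_eq_abs, abs_le']
    exact ⟨(hC₁ n x).trans ((le_max_left _ _).trans (le_max_right _ _)),
      (hC₂ n x).trans ((le_max_right _ _).trans (le_max_right _ _))⟩
  · rw [Metric.tendstoUniformlyOn_iff]
    intro ε hε
    filter_upwards [hup K hK ε hε, hlow K hK ε hε] with n h1 h2 x hx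
    have h3 := h1 x hx
    have h4 := h2 x hx
    rw [BoundedContinuousFunction.neg_apply] at h4
    rw [Real.dist_eq, abs_lt]
    constructor <;> linarith
end
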